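/- Let S be the skew-adjacency matrix of a tournament on n vertices and let Ŝ = [[S, S + Iₙ], [S − Iₙ, S]]. Then for every subset I of {1,…,2n}, det Ŝ[I] = det Ŝ[{1,…,2n} \ I], where Ŝ[I] is the principal submatrix of Ŝ on the rows and columns indexed by I. -/

import Mathlib

open Matrix

/-- A skew-adjacency matrix of a tournament: zero diagonal, skew-symmetric,
off-diagonal entries in `{-1, 1}`. -/
def IsTournament {n : ℕ} (S : Matrix (Fin n) (Fin n) ℤ) : Prop :=
  (∀ i, S i i = 0) ∧ Sᵀ = -S ∧ ∀ i j, i ≠ j → S i j = 1 ∨ S i j = -1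

/-- The principal minor of a matrix on the rows and columns indexed by `I`.
(The determinant of the empty matrix is `1`.) -/
def pminor {m : Type*} [Fintype m] [DecidableEq m]
    (M : Matrix m m ℤ) (I : Finset m) : ℤ :=
  (M.submatrix (fun x : I => (x : m)) (fun x : I => (x : m))).det

/-- Jacobi's complementary minor identity for principal minors. -/
theorem det_toSquareBlockProp_eq_of_mul_eq_one {m R : Type*} [Fintype m] [DecidableEq m]
    [CommRing R] {M N : Matrix m m R} (h : M * N = 1) (p : m → Prop) [DecidablePred p] :
    (M.toSquareBlockProp p).det = M.det * (N.toSquareBlockProp fun i => ¬p i).det := by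
  set P : Matrix m m R := of fun i j => if p j then (1 : Matrix m m R) i j else N i j with hP
  have hMP : M * P = of fun i j => if p j then M i j else (1 : Matrix m m R) i j := by
    ext i j
    by_cases hj : p j
    · simp [hP, mul_apply, hj, one_apply]
    · simp [hP, mul_apply, hj, ← h]
  have hdetP : P.det = (N.toSquareBlockProp fun i => ¬p i).det := by
    rw [twoBlockTriangular_det P p]
    · have h₁ : P.toSquareBlockProp p = 1 := by
        ext i j
        simp [hP, toSquareBlockProp_def, j.2, one_apply, Subtype.ext_iff]
      have h₂ : (P.toSquareBlockProp fun i => ¬p i) = N.toSquareBlockProp fun i => ¬p i := by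
        ext i j
        simp [hP, toSquareBlockProp_def, j.2]
      rw [h₁, h₂, det_one, one_mul]
    · intro i hi j hj
      have hij : i ≠ j := by rintro rfl; exact hi hj
      simp [hP, hj, hij]
  have hdetMP : (M * P).det = (M.toSquareBlockProp p).det := by
    rw [hMP, twoBlockTriangular_det' _ p]
    · have h₁ : (of fun i j => if p j then M i j else (1 : Matrix m m R) i j).toSquareBlockProp p
          = M.toSquareBlockProp p := by
        ext i j
        simp [toSquareBlockProp_def, j.2]
      have h₂ : ((of fun i j => if p j then M i j else (1 : Matrix m m R) i j).toSquareBlockProp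
          fun i => ¬p i) = 1 := by
        ext i j
        simp [toSquareBlockProp_def, j.2, one_apply, Subtype.ext_iff]
      rw [h₁, h₂, det_one, mul_one]
    · intro i hi j hj
      have hij : i ≠ j := by rintro rfl; exact hj hi
      simp [hj, hij]
  rw [← hdetMP, det_mul, hdetP]

theorem pminor_eq_det_mul_pminor_compl {m : Type*} [Fintype m] [DecidableEq m]
    {M N : Matrix m m ℤ} (h : M * N = 1) (I : Finset m) :
    pminor M I = M.det * pminor N Iᶜ := by
  have hI := det_toSquareBlockProp_eq_of_mul_eq_one h (· ∈ I)
  have hc : pminor N Iᶜ = (N.toSquareBlockProp fun i => ¬i ∈ I).det :=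
    (det_submatrix_equiv_self (Equiv.subtypeEquivRight fun i => Finset.mem_compl (s := I) (a := i))
      (N.toSquareBlockProp fun i => ¬i ∈ I))
  rw [hc, ← hI, pminor]
  convert rfl
  rfl

/-- Conjugating by a diagonal matrix of signs preserves principal minors. -/
theorem pminor_diagonal_mul_mul_diagonal {m : Type*} [Fintype m] [DecidableEq m]
    (M : Matrix m m ℤ) (d : m → ℤ) (hd : ∀ i, d i * d i = 1) (I : Finset m) :
    pminor (diagonal d * M * diagonal d) I = pminor M I := by
  have h : (diagonal d * M * diagonal d).submatrix (fun x : I => (x : m)) (fun x : I => (x : m)) =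
      diagonal (fun x : I => d x) * M.submatrix (fun x : I => (x : m)) (fun x : I => (x : m)) *
        diagonal (fun x : I => d x) := by
    ext i j
    simp
  rw [pminor, h, det_mul, det_mul, det_diagonal, mul_right_comm, ← Finset.prod_mul_distrib]
  simp [hd, pminor]

theorem det_fromBlocks_add_one_sub_one {m R : Type*} [Fintype m] [DecidableEq m] [CommRing R]
    (S : Matrix m m R) : (fromBlocks S (S + 1) (S - 1) S).det = 1 := by
  have h : fromBlocks S (S + 1) (S - 1) S = fromBlocks 1 1 0 1 * fromBlocks 1 1 (S - 1) S := by
    simp [fromBlocks_multiply, add_comm]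
  rw [h, det_mul, det_fromBlocks_zero₂₁, det_fromBlocks_one₁₁]
  simp

theorem hat_matrix_complementary_minors {n : ℕ} (S : Matrix (Fin n) (Fin n) ℤ)
    (hS : IsTournament S) :
    ∀ I : Finset (Fin n ⊕ Fin n),
      pminor (Matrix.fromBlocks S (S + 1) (S - 1) S) I =
        pminor (Matrix.fromBlocks S (S + 1) (S - 1) S) Iᶜ := by
  intro I
  set d : Fin n ⊕ Fin n → ℤ := Sum.elim (fun _ => 1) (fun _ => -1) with hd
  set M := fromBlocks S (S + 1) (S - 1) S with hM
  have hD : diagonal d = fromBlocks 1 0 0 (-1) := by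
    rw [hd, ← fromBlocks_diagonal, ← diagonal_one, diagonal_neg]
  have hinv : M * (diagonal d * M * diagonal d) = 1 := by
    rw [hD, hM, ← fromBlocks_one]
    simp only [fromBlocks_multiply]
    congr 1 <;> noncomm_ring
  rw [pminor_eq_det_mul_pminor_compl hinv, hM, det_fromBlocks_add_one_sub_one, one_mul,
    pminor_diagonal_mul_mul_diagonal]
  rintro (i | i) <;> simp [hd]
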